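/- Let α ∈ ℝ and z ∈ ℂ with Re(z) ≥ 1. Then 4 ζ_MT(1,1,1,z,1; 0,0,0,α,0) − ζ_MT(1,1,1,1,z; 0,0,0,0,α) = 12 ζ_MT(1,1,z,2; 0,0,α,0) + 24 [ ζ(2) ζ_MT(1,z,1; 0,α,0) − ζ_MT(1,z,3; 0,α,0) − ζ(2) Z(z+2; α) + Z(z+4; α) ], where Z(s; α) = Σ_{m≥1} e(mα)/m^s and ζ(2) = Z(2;0) is the Riemann zeta value. -/

import Mathlib

open Complex

/-- `e(x) = exp(2πix)`. -/
noncomputable def efn (x : ℝ) : ℂ := Complex.exp (2 * Real.pi * Complex.I * x)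

/-- The colored Mordell–Tornheim value `ζ_MT(s₁,…,s_k,t; α₁,…,α_{k+1})`. -/
noncomputable def MTC {k : ℕ} (s : Fin k → ℂ) (t : ℂ) (α : Fin (k + 1) → ℝ) : ℂ :=
  ∑' m : Fin k → ℕ+,
    (∏ j : Fin k, efn (((m j : ℕ) : ℝ) * α j.castSucc) * (((m j : ℕ) : ℂ) ^ s j)⁻¹) *
      (efn (((∑ j : Fin k, (m j : ℕ) : ℕ) : ℝ) * α (Fin.last k)) *
        ((∑ j : Fin k, ((m j : ℕ) : ℂ)) ^ t)⁻¹)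

/-- `Z(s;α) = Σ_{m≥1} e(mα)/m^s`. -/
noncomputable def Zfn (t : ℂ) (α : ℝ) : ℂ :=
  ∑' m : ℕ+, efn (((m : ℕ) : ℝ) * α) * (((m : ℕ) : ℂ) ^ t)⁻¹

section

open Filter Topology Finset

/-- The power series `-log (1 - X) = Σ Xᵐ / m`. -/
noncomputable def logSeries : PowerSeries ℝ := PowerSeries.mk fun m => (m : ℝ)⁻¹

/-- The sum of `1 / (a₁ ⋯ a_k)` over the compositions `a₁ + ⋯ + a_k = m`. -/
noncomputable def logCoeff (k m : ℕ) : ℝ := PowerSeries.coeff m (logSeries ^ k)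

/-- The generalized harmonic number `Σ_{i ≤ n} 1 / i ^ r`. -/
noncomputable def powHarmonic (r n : ℕ) : ℝ := ∑ i ∈ range n, (((i : ℝ) + 1) ^ r)⁻¹

lemma powHarmonic_zero (r : ℕ) : powHarmonic r 0 = 0 := by simp [powHarmonic]

lemma powHarmonic_succ (r n : ℕ) :
    powHarmonic r (n + 1) = powHarmonic r n + (((n : ℝ) + 1) ^ r)⁻¹ := by
  simp [powHarmonic, sum_range_succ]

lemma powHarmonic_nonneg (r n : ℕ) : 0 ≤ powHarmonic r n :=
  sum_nonneg fun i _ => by positivity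

lemma powHarmonic_mono (r : ℕ) : Monotone (powHarmonic r) :=
  monotone_nat_of_le_succ fun n => by
    rw [powHarmonic_succ]
    have : (0 : ℝ) ≤ (((n : ℝ) + 1) ^ r)⁻¹ := by positivity
    linarith

lemma derivative_logSeries :
    (1 - PowerSeries.X) * PowerSeries.derivative ℝ logSeries = 1 := by
  have : PowerSeries.derivative ℝ logSeries = PowerSeries.mk 1 := by
    ext n
    rw [PowerSeries.coeff_derivative, logSeries, PowerSeries.coeff_mk, PowerSeries.coeff_mk]
    push_cast
    simp only [Pi.one_apply]
    field_simp
  rw [this, mul_comm]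
  exact PowerSeries.mk_one_mul_one_sub_eq_one ℝ

lemma logCoeff_recurrence (k m : ℕ) :
    ((m : ℝ) + 1) * logCoeff (k + 1) (m + 1) - m * logCoeff (k + 1) m
      = (k + 1) * logCoeff k m := by
  have h : (1 - PowerSeries.X) * PowerSeries.derivative ℝ (logSeries ^ (k + 1))
      = PowerSeries.C ((k : ℝ) + 1) * logSeries ^ k := by
    rw [Derivation.leibniz_pow]
    simp only [Nat.add_sub_cancel, nsmul_eq_mul, smul_eq_mul, map_add, map_natCast, map_one]
    push_cast
    linear_combination (((k : PowerSeries ℝ) + 1) * logSeries ^ k) * derivative_logSeries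
  have h2 := congrArg (PowerSeries.coeff m) h
  rw [PowerSeries.coeff_C_mul, sub_mul, one_mul, map_sub, PowerSeries.coeff_derivative] at h2
  rcases m with _ | m
  · simp at h2
    simp [logCoeff]
    linarith
  · rw [PowerSeries.coeff_succ_X_mul, PowerSeries.coeff_derivative] at h2
    simp only [logCoeff]
    push_cast at h2 ⊢
    linarith

lemma logCoeff_zero_left (m : ℕ) : logCoeff 0 m = if m = 0 then 1 else 0 := by
  simp [logCoeff, PowerSeries.coeff_one]

lemma logCoeff_succ_zero (k : ℕ) : logCoeff (k + 1) 0 = 0 := by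
  simp [logCoeff, logSeries]

lemma logCoeff_one (m : ℕ) : logCoeff 1 m = (m : ℝ)⁻¹ := by
  simp [logCoeff, logSeries]

lemma mul_logCoeff_succ (k m : ℕ) :
    (m : ℝ) * logCoeff (k + 1) m = (k + 1) * ∑ j ∈ range m, logCoeff k j := by
  induction m with
  | zero => simp
  | succ m ih =>
    rw [sum_range_succ, mul_add, ← ih]
    push_cast
    linarith [logCoeff_recurrence k m]

lemma logCoeff_nonneg (k m : ℕ) : 0 ≤ logCoeff k m := by
  induction k generalizing m with
  | zero => rw [logCoeff_zero_left]; split_ifs <;> norm_num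
  | succ k ih =>
    rcases m with _ | m
    · rw [logCoeff_succ_zero]
    · have h := mul_logCoeff_succ k (m + 1)
      have h1 : 0 ≤ ((k : ℝ) + 1) * ∑ j ∈ range (m + 1), logCoeff k j :=
        mul_nonneg (by positivity) (sum_nonneg fun j _ => ih j)
      rw [← h] at h1
      exact nonneg_of_mul_nonneg_right h1 (by positivity)

lemma tendsto_logCoeff (k : ℕ) : Tendsto (logCoeff k) atTop (𝓝 0) := by
  induction k with
  | zero =>
    refine tendsto_const_nhds.congr' ?_
    filter_upwards [eventually_ne_atTop 0] with m hm
    simp [logCoeff_zero_left, hm]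
  | succ k ih =>
    have h := ih.cesaro.const_mul ((k : ℝ) + 1)
    rw [mul_zero] at h
    refine h.congr' ?_
    filter_upwards [eventually_ne_atTop 0] with m hm
    have hm' : (m : ℝ) ≠ 0 := by exact_mod_cast hm
    have := mul_logCoeff_succ k m
    field_simp
    linarith

lemma logCoeff_two (m : ℕ) : ((m : ℝ) + 1) * logCoeff 2 (m + 1) = 2 * powHarmonic 1 m := by
  induction m with
  | zero =>
    have h := logCoeff_recurrence 1 0
    simp [logCoeff_one] at h
    simp [h, powHarmonic_zero]
  | succ m ih =>
    have := logCoeff_recurrence 1 (m + 1)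
    rw [logCoeff_one] at this
    rw [powHarmonic_succ, pow_one]
    push_cast at this ⊢
    linarith

lemma logCoeff_three (m : ℕ) :
    ((m : ℝ) + 1) * logCoeff 3 (m + 1) = 3 * (powHarmonic 1 m ^ 2 - powHarmonic 2 m) := by
  induction m with
  | zero =>
    have h := logCoeff_recurrence 2 0
    have h0 : logCoeff 2 0 = 0 := logCoeff_succ_zero 1
    rw [h0] at h
    simp at h
    simp [h, powHarmonic_zero]
  | succ m ih =>
    have h := logCoeff_recurrence 2 (m + 1)
    have h2 := logCoeff_two m
    have hm : (m : ℝ) + 1 ≠ 0 := by positivity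
    rw [mul_comm, ← eq_div_iff hm] at h2
    rw [h2] at h
    rw [powHarmonic_succ, powHarmonic_succ]
    push_cast at h ⊢
    rw [eq_add_of_sub_eq h, ih]
    field_simp
    ring

lemma logCoeff_four (m : ℕ) :
    ((m : ℝ) + 1) * logCoeff 4 (m + 1)
      = 4 * (powHarmonic 1 m ^ 3 - 3 * powHarmonic 1 m * powHarmonic 2 m
        + 2 * powHarmonic 3 m) := by
  induction m with
  | zero =>
    have h := logCoeff_recurrence 3 0
    have h0 : logCoeff 3 0 = 0 := logCoeff_succ_zero 2
    rw [h0] at h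
    simp at h
    simp [h, powHarmonic_zero]
  | succ m ih =>
    have h := logCoeff_recurrence 3 (m + 1)
    have h2 := logCoeff_three m
    have hm : (m : ℝ) + 1 ≠ 0 := by positivity
    rw [mul_comm, ← eq_div_iff hm] at h2
    rw [h2] at h
    rw [powHarmonic_succ, powHarmonic_succ, powHarmonic_succ]
    push_cast at h ⊢
    rw [eq_add_of_sub_eq h, ih]
    field_simp
    ring

/-- Abel summation for nonnegative terms. -/
lemma hasSum_abel {A g : ℕ → ℝ} {s : ℝ} (hA0 : A 0 = 0) (hA : ∀ m, 0 ≤ A m) (hg : Antitone g)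
    (hlim : Tendsto (fun m => A m * g m) atTop (𝓝 0))
    (hs : HasSum (fun m => (A (m + 1) - A m) * g m) s) :
    HasSum (fun m => A (m + 1) * (g m - g (m + 1))) s := by
  rw [hasSum_iff_tendsto_nat_of_nonneg
    fun m => mul_nonneg (hA _) (sub_nonneg.2 (hg (Nat.le_succ m)))]
  have h := hs.tendsto_sum_nat.sub hlim
  rw [sub_zero] at h
  refine h.congr fun n => ?_
  induction n with
  | zero => simp [hA0]
  | succ n ih => rw [sum_range_succ, sum_range_succ, ← ih]; ring

lemma hasSum_logCoeff_shift (k : ℕ) (g : ℕ → ℝ) (s : ℝ) :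
    HasSum (fun m => logCoeff (k + 1) m * g m) s ↔
      HasSum (fun m => logCoeff (k + 1) (m + 1) * g (m + 1)) s := by
  rw [← hasSum_nat_add_iff' 1]
  simp [logCoeff_succ_zero]

lemma hasSum_logCoeff_succ {k : ℕ} {τ σ : ℕ → ℝ}
    (hτ : ∀ n : ℕ, HasSum (fun m : ℕ => logCoeff k m * ((m : ℝ) + n + 1)⁻¹) (τ n))
    (h0 : σ 0 = (k + 1) * τ 0)
    (hσ : ∀ n : ℕ, ((n : ℝ) + 2) * σ (n + 1) = (n + 1) * σ n + (k + 1) * τ (n + 1)) (n : ℕ) :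
    HasSum (fun m : ℕ => logCoeff (k + 1) m * ((m : ℝ) + n + 1)⁻¹) (σ n) := by
  have key (n : ℕ) : HasSum (fun m : ℕ => ((m : ℝ) + 1) * logCoeff (k + 1) (m + 1) *
      (((m : ℝ) + n + 1)⁻¹ - ((m : ℝ) + n + 2)⁻¹)) ((k + 1) * τ n) := by
    have := hasSum_abel (A := fun m => m * logCoeff (k + 1) m)
      (g := fun m : ℕ => ((m : ℝ) + n + 1)⁻¹) (s := (k + 1) * τ n) (by simp)
      (fun m => mul_nonneg (by positivity) (logCoeff_nonneg _ _))
      (fun a b hab => by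
        have : (a : ℝ) ≤ b := by exact_mod_cast hab
        dsimp only
        gcongr) ?_ ?_
    · refine this.congr_fun fun m => ?_
      push_cast
      ring
    · refine squeeze_zero (fun m => ?_) (fun m => ?_) (tendsto_logCoeff (k + 1))
      · have := logCoeff_nonneg (k + 1) m
        positivity
      · have := logCoeff_nonneg (k + 1) m
        rw [mul_comm (m : ℝ), mul_assoc]
        refine mul_le_of_le_one_right this ?_
        rw [← div_eq_mul_inv, div_le_one (by positivity)]
        have : (0 : ℝ) ≤ n := by positivity
        linarith
    · have h := (hτ n).mul_left ((k : ℝ) + 1)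
      refine h.congr_fun fun m => ?_
      push_cast
      rw [logCoeff_recurrence]
      ring
  have shift (n : ℕ) (s : ℝ) :
      HasSum (fun m : ℕ => logCoeff (k + 1) m * ((m : ℝ) + n + 1)⁻¹) s ↔
        HasSum (fun m : ℕ => logCoeff (k + 1) (m + 1) * ((m : ℝ) + n + 2)⁻¹) s := by
    rw [hasSum_logCoeff_shift]
    refine iff_of_eq (congrArg (fun f => HasSum f s) (funext fun m => ?_))
    push_cast
    ring
  induction n with
  | zero =>
    rw [shift, h0]
    refine (key 0).congr_fun fun m => ?_
    have : (m : ℝ) + 1 ≠ 0 := by positivity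
    have : (m : ℝ) + 2 ≠ 0 := by positivity
    push_cast
    field_simp
    ring
  | succ n ih =>
    rw [shift]
    have h2 : ((n : ℝ) + 2) ≠ 0 := by positivity
    have h := (((((shift n _).1 ih).mul_left ((n : ℝ) + 1)).add (key (n + 1))).mul_left
      ((n : ℝ) + 2)⁻¹)
    rw [← hσ, inv_mul_cancel_left₀ h2] at h
    refine h.congr_fun fun m => ?_
    have : (m : ℝ) + n + 2 ≠ 0 := by positivity
    have : (m : ℝ) + n + 3 ≠ 0 := by positivity
    push_cast
    rw [show (m : ℝ) + (n + 1) + 1 = m + n + 2 by ring,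
      show (m : ℝ) + (n + 1) + 2 = m + n + 3 by ring]
    field_simp
    ring

lemma hasSum_logCoeff_zero (n : ℕ) :
    HasSum (fun m : ℕ => logCoeff 0 m * ((m : ℝ) + n + 1)⁻¹) ((n : ℝ) + 1)⁻¹ := by
  have := hasSum_ite_eq (0 : ℕ) ((n : ℝ) + 1)⁻¹
  refine this.congr_fun fun m => ?_
  rw [logCoeff_zero_left]
  split_ifs with h <;> simp [h]

lemma hasSum_logCoeff_one (n : ℕ) :
    HasSum (fun m : ℕ => logCoeff 1 m * ((m : ℝ) + n + 1)⁻¹)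
      (powHarmonic 1 (n + 1) * ((n : ℝ) + 1)⁻¹) := by
  refine hasSum_logCoeff_succ (σ := fun n : ℕ => powHarmonic 1 (n + 1) * ((n : ℝ) + 1)⁻¹)
    hasSum_logCoeff_zero ?_ (fun n => ?_) n
  · simp [powHarmonic]
  · have : (n : ℝ) + 2 ≠ 0 := by positivity
    rw [powHarmonic_succ _ (n + 1)]
    push_cast
    rw [show (n : ℝ) + 1 + 1 = n + 2 by ring]
    field_simp
    ring

lemma hasSum_logCoeff_two (n : ℕ) :
    HasSum (fun m : ℕ => logCoeff 2 m * ((m : ℝ) + n + 1)⁻¹)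
      ((powHarmonic 1 (n + 1) ^ 2 + powHarmonic 2 (n + 1)) * ((n : ℝ) + 1)⁻¹) := by
  refine hasSum_logCoeff_succ
    (σ := fun n : ℕ => (powHarmonic 1 (n + 1) ^ 2 + powHarmonic 2 (n + 1)) * ((n : ℝ) + 1)⁻¹)
    hasSum_logCoeff_one ?_ (fun n => ?_) n
  · norm_num [powHarmonic]
  · have : (n : ℝ) + 2 ≠ 0 := by positivity
    rw [powHarmonic_succ _ (n + 1), powHarmonic_succ _ (n + 1)]
    push_cast
    rw [show (n : ℝ) + 1 + 1 = n + 2 by ring]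
    field_simp
    ring

lemma hasSum_logCoeff_three (n : ℕ) :
    HasSum (fun m : ℕ => logCoeff 3 m * ((m : ℝ) + n + 1)⁻¹)
      ((powHarmonic 1 (n + 1) ^ 3 + 3 * powHarmonic 1 (n + 1) * powHarmonic 2 (n + 1)
        + 2 * powHarmonic 3 (n + 1)) * ((n : ℝ) + 1)⁻¹) := by
  refine hasSum_logCoeff_succ
    (σ := fun n : ℕ => (powHarmonic 1 (n + 1) ^ 3
      + 3 * powHarmonic 1 (n + 1) * powHarmonic 2 (n + 1)
      + 2 * powHarmonic 3 (n + 1)) * ((n : ℝ) + 1)⁻¹)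
    hasSum_logCoeff_two ?_ (fun n => ?_) n
  · norm_num [powHarmonic]
  · have : (n : ℝ) + 2 ≠ 0 := by positivity
    rw [powHarmonic_succ _ (n + 1), powHarmonic_succ _ (n + 1), powHarmonic_succ _ (n + 1)]
    push_cast
    rw [show (n : ℝ) + 1 + 1 = n + 2 by ring]
    field_simp
    ring

/-- The tail `Σ_{i > n} 1 / i ^ r`. -/
noncomputable def zetaTail (r n : ℕ) : ℝ :=
  ∑' m : ℕ, (((m : ℝ) + 1) ^ r)⁻¹ - powHarmonic r n

lemma hasSum_zetaTail {r : ℕ} (hr : 2 ≤ r) (n : ℕ) :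
    HasSum (fun m : ℕ => (((m : ℝ) + n + 1) ^ r)⁻¹) (zetaTail r n) := by
  have h : Summable fun m : ℕ => (((m : ℝ) + 1) ^ r)⁻¹ := by
    have := (summable_nat_add_iff 1).2 (Real.summable_nat_pow_inv.2 (show 1 < r by omega))
    simpa using this
  have := (hasSum_nat_add_iff' n).2 h.hasSum
  simpa [zetaTail, powHarmonic] using this

lemma zetaTail_succ (r n : ℕ) :
    zetaTail r (n + 1) = zetaTail r n - (((n : ℝ) + 1) ^ r)⁻¹ := by
  rw [zetaTail, zetaTail, powHarmonic_succ]
  ring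

lemma hasSum_logCoeff_one_sq (n : ℕ) :
    HasSum (fun m : ℕ => logCoeff 1 m * (((m : ℝ) + n + 1) ^ 2)⁻¹)
      ((powHarmonic 1 (n + 1) * ((n : ℝ) + 1)⁻¹ - zetaTail 2 (n + 1)) * ((n : ℝ) + 1)⁻¹) := by
  have h := (((hasSum_logCoeff_shift 0 (fun m => ((m : ℝ) + n + 1)⁻¹) _).1
    (hasSum_logCoeff_one n)).sub (hasSum_zetaTail le_rfl (n + 1))).mul_right ((n : ℝ) + 1)⁻¹
  refine (hasSum_logCoeff_shift 0 (fun m => (((m : ℝ) + n + 1) ^ 2)⁻¹) _).2 ?_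
  refine h.congr_fun fun m => ?_
  have : (n : ℝ) + 1 ≠ 0 := by positivity
  have : (m : ℝ) + 1 ≠ 0 := by positivity
  have : (m : ℝ) + n + 2 ≠ 0 := by positivity
  rw [zero_add, logCoeff_one]
  push_cast
  rw [show (m : ℝ) + 1 + n + 1 = m + n + 2 by ring,
    show (m : ℝ) + (n + 1) + 1 = m + n + 2 by ring]
  field_simp
  ring

lemma hasSum_logCoeff_one_cube (n : ℕ) :
    HasSum (fun m : ℕ => logCoeff 1 m * (((m : ℝ) + n + 1) ^ 3)⁻¹)
      (((powHarmonic 1 (n + 1) * ((n : ℝ) + 1)⁻¹ - zetaTail 2 (n + 1)) * ((n : ℝ) + 1)⁻¹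
        - zetaTail 3 (n + 1)) * ((n : ℝ) + 1)⁻¹) := by
  have h := (((hasSum_logCoeff_shift 0 (fun m => (((m : ℝ) + n + 1) ^ 2)⁻¹) _).1
    (hasSum_logCoeff_one_sq n)).sub
      (hasSum_zetaTail (r := 3) (by norm_num) (n + 1))).mul_right ((n : ℝ) + 1)⁻¹
  refine (hasSum_logCoeff_shift 0 (fun m => (((m : ℝ) + n + 1) ^ 3)⁻¹) _).2 ?_
  refine h.congr_fun fun m => ?_
  have : (n : ℝ) + 1 ≠ 0 := by positivity
  have : (m : ℝ) + 1 ≠ 0 := by positivity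
  have : (m : ℝ) + n + 2 ≠ 0 := by positivity
  rw [zero_add, logCoeff_one]
  push_cast
  rw [show (m : ℝ) + 1 + n + 1 = m + n + 2 by ring,
    show (m : ℝ) + (n + 1) + 1 = m + n + 2 by ring]
  field_simp
  ring

lemma summable_powHarmonic_div_sq :
    Summable fun m : ℕ => powHarmonic 1 m * (((m : ℝ) + 1) ^ 2)⁻¹ := by
  have h := ((hasSum_logCoeff_shift 1 (fun m => ((m : ℝ) + (0 : ℕ) + 1)⁻¹) _).1
    (hasSum_logCoeff_two 0)).summable
  refine Summable.of_nonneg_of_le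
    (fun m => mul_nonneg (powHarmonic_nonneg _ _) (by positivity)) (fun m => ?_) h
  have h2 := logCoeff_two m
  have h0 := powHarmonic_nonneg 1 m
  have hm : (m : ℝ) + 1 ≠ 0 := by positivity
  rw [mul_comm, ← eq_div_iff hm] at h2
  rw [show 1 + 1 = 2 from rfl, h2, div_mul_eq_mul_div, le_div_iff₀ (by positivity)]
  push_cast
  have : (((m : ℝ) + 1) ^ 2)⁻¹ * (m + 1) ≤ 2 * ((m : ℝ) + 1 + 0 + 1)⁻¹ := by
    rw [← div_eq_mul_inv, inv_mul_eq_div, div_le_div_iff₀ (by positivity) (by positivity)]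
    nlinarith [(by positivity : (0 : ℝ) ≤ m)]
  calc _ = powHarmonic 1 m * ((((m : ℝ) + 1) ^ 2)⁻¹ * (m + 1)) := by ring
    _ ≤ powHarmonic 1 m * (2 * ((m : ℝ) + 1 + 0 + 1)⁻¹) := by gcongr
    _ = _ := by ring

lemma hasSum_powHarmonic_div_sq (n : ℕ) :
    HasSum (fun m : ℕ => powHarmonic 1 m * (((m : ℝ) + n + 1) ^ 2)⁻¹)
      (powHarmonic 1 n * zetaTail 2 n + zetaTail 3 n) := by
  have hs (n : ℕ) : Summable fun m : ℕ => powHarmonic 1 m * (((m : ℝ) + n + 1) ^ 2)⁻¹ := by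
    refine Summable.of_nonneg_of_le
      (fun m => mul_nonneg (powHarmonic_nonneg _ _) (by positivity)) (fun m => ?_)
      summable_powHarmonic_div_sq
    have := powHarmonic_nonneg 1 m
    have : (0 : ℝ) ≤ n := by positivity
    gcongr
    linarith
  set y : ℕ → ℝ := fun n => ∑' m : ℕ, powHarmonic 1 m * (((m : ℝ) + n + 1) ^ 2)⁻¹ with hy
  set d : ℕ → ℝ := fun n => y n - (powHarmonic 1 n * zetaTail 2 n + zetaTail 3 n) with hd
  have htail : Tendsto (fun n : ℕ => ∑' m : ℕ, powHarmonic 1 (m + n) *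
      (((m : ℝ) + n + 1) ^ 2)⁻¹) atTop (𝓝 0) := by
    have := tendsto_sum_nat_add fun m : ℕ => powHarmonic 1 m * (((m : ℝ) + 1) ^ 2)⁻¹
    simpa using this
  have hts (n : ℕ) : Summable fun m : ℕ => powHarmonic 1 (m + n) *
      (((m : ℝ) + n + 1) ^ 2)⁻¹ := by
    have := (summable_nat_add_iff n).2 summable_powHarmonic_div_sq
    simpa using this
  have hpos (n m : ℕ) : 0 ≤ (((m : ℝ) + n + 1) ^ 2)⁻¹ := by positivity
  have hylim : Tendsto y atTop (𝓝 0) := by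
    refine squeeze_zero (fun n => tsum_nonneg fun m =>
      mul_nonneg (powHarmonic_nonneg _ _) (hpos _ _)) (fun n => ?_) htail
    exact (hs n).tsum_le_tsum (fun m => mul_le_mul_of_nonneg_right
      (powHarmonic_mono 1 (by omega)) (hpos _ _)) (hts n)
  have hplim : Tendsto (fun n => powHarmonic 1 n * zetaTail 2 n) atTop (𝓝 0) := by
    have hz (n : ℕ) := (hasSum_zetaTail le_rfl n).mul_left (powHarmonic 1 n)
    refine squeeze_zero (fun n => (hz n).nonneg fun m =>
      mul_nonneg (powHarmonic_nonneg _ _) (hpos _ _)) (fun n => ?_) htail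
    refine hasSum_le (fun m => mul_le_mul_of_nonneg_right
      (powHarmonic_mono 1 (by omega)) (hpos _ _)) (hz n) (hts n).hasSum
  have hzlim : Tendsto (zetaTail 3) atTop (𝓝 0) := by
    have := tendsto_sum_nat_add fun m : ℕ => (((m : ℝ) + 1) ^ 3)⁻¹
    refine this.congr fun n => ?_
    have := (hasSum_zetaTail (r := 3) (by norm_num) n).tsum_eq
    simpa using this
  have hdlim : Tendsto d atTop (𝓝 0) := by
    simpa using hylim.sub (hplim.add hzlim)
  have hstep (n : ℕ) : d (n + 1) = d n := by
    have h1 := (hasSum_nat_add_iff' 1).2 (hs n).hasSum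
    simp only [range_one, sum_singleton, powHarmonic_zero, zero_mul, sub_zero] at h1
    have h2 := h1.sub (hs (n + 1)).hasSum
    have h3 := (hasSum_logCoeff_shift 0 (fun m => (((m : ℝ) + n + 1) ^ 2)⁻¹) _).1
      (hasSum_logCoeff_one_sq n)
    have h4 : y n - y (n + 1) = _ := h2.unique (h3.congr_fun fun m => ?_)
    · have hn : (n : ℝ) + 1 ≠ 0 := by positivity
      simp only [hd]
      rw [eq_sub_of_add_eq (sub_eq_iff_eq_add'.1 h4).symm]
      rw [powHarmonic_succ, zetaTail_succ, zetaTail_succ]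
      field_simp
      ring
    · rw [zero_add, logCoeff_one, powHarmonic_succ]
      push_cast
      rw [show (m : ℝ) + 1 + n + 1 = m + n + 2 by ring,
        show (m : ℝ) + (n + 1) + 1 = m + n + 2 by ring]
      ring
  have hconst (n : ℕ) : d n = d 0 := by
    induction n with
    | zero => rfl
    | succ n ih => rw [hstep, ih]
  have h0 : d 0 = 0 := by
    refine tendsto_nhds_unique (tendsto_const_nhds.congr fun n => ?_) hdlim
    exact (hconst n).symm
  have : y n = powHarmonic 1 n * zetaTail 2 n + zetaTail 3 n :=
    sub_eq_zero.1 ((hconst n).trans h0)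
  exact this ▸ (hs n).hasSum

lemma hasSum_logCoeff_two_sq (n : ℕ) :
    HasSum (fun m : ℕ => logCoeff 2 m * (((m : ℝ) + n + 1) ^ 2)⁻¹)
      (((powHarmonic 1 (n + 1) ^ 2 + powHarmonic 2 (n + 1)) * ((n : ℝ) + 1)⁻¹
        - 2 * (powHarmonic 1 (n + 1) * zetaTail 2 (n + 1) + zetaTail 3 (n + 1)))
          * ((n : ℝ) + 1)⁻¹) := by
  have h := (((hasSum_logCoeff_shift 1 (fun m => ((m : ℝ) + n + 1)⁻¹) _).1
    (hasSum_logCoeff_two n)).sub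
      ((hasSum_powHarmonic_div_sq (n + 1)).mul_left 2)).mul_right ((n : ℝ) + 1)⁻¹
  refine (hasSum_logCoeff_shift 1 (fun m => (((m : ℝ) + n + 1) ^ 2)⁻¹) _).2 ?_
  refine h.congr_fun fun m => ?_
  have : (n : ℝ) + 1 ≠ 0 := by positivity
  have hm : (m : ℝ) + 1 ≠ 0 := by positivity
  have : (m : ℝ) + n + 2 ≠ 0 := by positivity
  have h2 := logCoeff_two m
  rw [mul_comm, ← eq_div_iff hm] at h2
  rw [show 1 + 1 = 2 from rfl, h2]
  push_cast
  rw [show (m : ℝ) + 1 + n + 1 = m + n + 2 by ring,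
    show (m : ℝ) + (n + 1) + 1 = m + n + 2 by ring]
  field_simp
  ring

lemma logCoeff_identity (n : ℕ) :
    4 * ∑' m : ℕ, logCoeff 3 m * ((m : ℝ) + n + 1)⁻¹ - logCoeff 4 (n + 1)
      = 12 * ∑' m : ℕ, logCoeff 2 m * (((m : ℝ) + n + 1) ^ 2)⁻¹
        + 24 * ((∑' m : ℕ, (((m : ℝ) + 1) ^ 2)⁻¹)
              * ∑' m : ℕ, logCoeff 1 m * ((m : ℝ) + n + 1)⁻¹
            - ∑' m : ℕ, logCoeff 1 m * (((m : ℝ) + n + 1) ^ 3)⁻¹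
            - (∑' m : ℕ, (((m : ℝ) + 1) ^ 2)⁻¹) * (((n : ℝ) + 1) ^ 2)⁻¹
            + (((n : ℝ) + 1) ^ 4)⁻¹) := by
  have hn : (n : ℝ) + 1 ≠ 0 := by positivity
  have h4 := logCoeff_four n
  rw [mul_comm, ← eq_div_iff hn] at h4
  rw [(hasSum_logCoeff_three n).tsum_eq, (hasSum_logCoeff_two_sq n).tsum_eq,
    (hasSum_logCoeff_one n).tsum_eq, (hasSum_logCoeff_one_cube n).tsum_eq, h4]
  simp only [zetaTail, powHarmonic_succ]
  field_simp
  ring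

lemma exists_hasSum_logCoeff (k : ℕ) : ∃ τ : ℕ → ℝ, ∀ n : ℕ,
    HasSum (fun m : ℕ => logCoeff k m * ((m : ℝ) + n + 1)⁻¹) (τ n) := by
  induction k with
  | zero => exact ⟨_, hasSum_logCoeff_zero⟩
  | succ k ih =>
    obtain ⟨τ, hτ⟩ := ih
    refine ⟨fun n => ((n : ℝ) + 1)⁻¹ * ((k + 1) * ∑ j ∈ range (n + 1), τ j),
      hasSum_logCoeff_succ hτ (by simp) fun n => ?_⟩
    have : (n : ℝ) + 2 ≠ 0 := by positivity
    rw [sum_range_succ _ (n + 1)]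
    push_cast
    rw [show (n : ℝ) + 1 + 1 = n + 2 by ring]
    field_simp

lemma summable_logCoeff_div (k : ℕ) : Summable fun m : ℕ => logCoeff k m * (m : ℝ)⁻¹ := by
  obtain ⟨τ, hτ⟩ := exists_hasSum_logCoeff k
  refine Summable.of_nonneg_of_le (fun m => mul_nonneg (logCoeff_nonneg _ _) (by positivity))
    (fun m => ?_) ((hτ 0).summable.mul_left 2)
  have h0 := logCoeff_nonneg k m
  have : (m : ℝ)⁻¹ ≤ 2 * ((m : ℝ) + (0 : ℕ) + 1)⁻¹ := by
    rcases m with _ | m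
    · norm_num
    · rw [← div_eq_mul_inv, ← one_div, div_le_div_iff₀ (by positivity) (by positivity)]
      push_cast
      linarith [(by positivity : (0 : ℝ) ≤ m)]
  calc _ ≤ logCoeff k m * (2 * ((m : ℝ) + (0 : ℕ) + 1)⁻¹) := by gcongr
    _ = _ := by ring

lemma logCoeff_eq_sum (k m : ℕ) :
    logCoeff k m = ∑ v ∈ finAntidiagonal k m, ∏ j, (v j : ℝ)⁻¹ := by
  have h : logSeries ^ k = ∏ _j : Fin k, logSeries := by simp
  rw [logCoeff, h, PowerSeries.coeff_prod]
  refine sum_equiv Finsupp.equivFunOnFinite (fun l => ?_) fun l _ => ?_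
  · simp [mem_finsuppAntidiag, mem_finAntidiagonal]
  · simp [logSeries]

lemma sum_fiber {k : ℕ} (F : ℕ → ℂ) (m : ℕ) :
    ∑' v : (fun v : Fin k → ℕ => ∑ j, v j) ⁻¹' {m},
      (∏ j, ((v : Fin k → ℕ) j : ℂ)⁻¹) * F (∑ j, (v : Fin k → ℕ) j)
      = (logCoeff k m : ℂ) * F m := by
  have h : (fun v : Fin k → ℕ => ∑ j, v j) ⁻¹' {m} = ↑(finAntidiagonal k m) := by
    ext v
    simp
  rw [h, Finset.tsum_subtype' (finAntidiagonal k m)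
    (fun v : Fin k → ℕ => (∏ j, (v j : ℂ)⁻¹) * F (∑ j, v j)), logCoeff_eq_sum]
  push_cast
  rw [sum_mul]
  exact sum_congr rfl fun v hv => by rw [mem_finAntidiagonal.1 hv]

lemma hasSum_logCoeff_mul {k : ℕ} {F : ℕ → ℂ}
    (h : Summable fun v : Fin k → ℕ => (∏ j, (v j : ℂ)⁻¹) * F (∑ j, v j)) :
    HasSum (fun m => (logCoeff k m : ℂ) * F m)
      (∑' v : Fin k → ℕ, (∏ j, (v j : ℂ)⁻¹) * F (∑ j, v j)) := by
  simpa only [sum_fiber] using h.hasSum.tsum_fiberwise fun v : Fin k → ℕ => ∑ j, v j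

lemma summable_prod_inv_div_sum (k : ℕ) :
    Summable fun v : Fin k → ℕ => (∏ j, (v j : ℝ)⁻¹) * ((∑ j, v j : ℕ) : ℝ)⁻¹ := by
  set G : (Fin k → ℕ) → ℝ := fun v => (∏ j, (v j : ℝ)⁻¹) * ((∑ j, v j : ℕ) : ℝ)⁻¹ with hG
  have hG0 (v) : 0 ≤ G v := by positivity
  have hset (m : ℕ) : {v : Fin k → ℕ | ∑ j, v j = m} = ↑(finAntidiagonal k m) := by
    ext v
    simp
  rw [← (Equiv.sigmaFiberEquiv fun v : Fin k → ℕ => ∑ j, v j).summable_iff,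
    summable_sigma_of_nonneg (f := G ∘ _) fun x => hG0 _]
  refine ⟨fun m => ?_, (summable_logCoeff_div k).congr fun m => ?_⟩
  · have : Finite {v : Fin k → ℕ // ∑ j, v j = m} :=
      (hset m ▸ (finAntidiagonal k m).finite_toSet : {v : Fin k → ℕ | ∑ j, v j = m}.Finite)
    exact Summable.of_finite
  · change _ = ∑' v : {v : Fin k → ℕ | ∑ j, v j = m}, G v
    rw [hset, Finset.tsum_subtype', logCoeff_eq_sum, sum_mul]
    exact sum_congr rfl fun v hv => by rw [hG, ← mem_finAntidiagonal.1 hv]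

lemma tsum_pnat_pi {k : ℕ} {G : (Fin k → ℕ) → ℂ} (hG : ∀ v j, v j = 0 → G v = 0) :
    ∑' m : Fin k → ℕ+, G (fun j => m j) = ∑' v, G v := by
  refine Function.Injective.tsum_eq (g := fun (m : Fin k → ℕ+) j => (m j : ℕ))
    (fun a b hab => funext fun j => PNat.coe_injective (congrFun hab j)) fun v hv => ?_
  exact ⟨fun j => ⟨v j, Nat.pos_of_ne_zero fun h => hv (hG v j h)⟩, rfl⟩

lemma efn_zero : efn 0 = 1 := by simp [efn]

lemma norm_efn (x : ℝ) : ‖efn x‖ = 1 := by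
  rw [efn, show (2 * Real.pi * I * x : ℂ) = ((2 * Real.pi * x : ℝ) : ℂ) * I by push_cast; ring]
  exact norm_exp_ofReal_mul_I _

/-- The `n`-th term `e(nα) / n ^ z` of the series `Z(z;α)`. -/
noncomputable def zetaTerm (α : ℝ) (z : ℂ) (n : ℕ) : ℂ := efn (n * α) * ((n : ℂ) ^ z)⁻¹

lemma zetaTerm_zero {α : ℝ} {z : ℂ} (hz : 1 ≤ z.re) : zetaTerm α z 0 = 0 := by
  have : z ≠ 0 := by rintro rfl; norm_num at hz
  simp [zetaTerm, zero_cpow this]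

lemma norm_zetaTerm_le {α : ℝ} {z : ℂ} (hz : 1 ≤ z.re) (n : ℕ) :
    ‖zetaTerm α z n‖ ≤ (n : ℝ)⁻¹ := by
  rcases Nat.eq_zero_or_pos n with rfl | hn
  · simp [zetaTerm_zero hz]
  · rw [zetaTerm, norm_mul, norm_efn, one_mul, norm_inv, norm_natCast_cpow_of_pos hn]
    have h1 : (1 : ℝ) ≤ n := by exact_mod_cast hn
    gcongr
    simpa using Real.rpow_le_rpow_of_exponent_le h1 hz

lemma Zfn_eq_tsum {α : ℝ} {t : ℂ} (ht : 1 ≤ t.re) : Zfn t α = ∑' n : ℕ, zetaTerm α t n := by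
  refine Function.Injective.tsum_eq (g := ((↑) : ℕ+ → ℕ)) (f := zetaTerm α t)
    PNat.coe_injective fun n hn => ?_
  exact ⟨⟨n, Nat.pos_of_ne_zero fun h => hn (h ▸ zetaTerm_zero ht)⟩, rfl⟩

lemma zetaTerm_add {α : ℝ} {z : ℂ} (hz : 1 ≤ z.re) (p n : ℕ) :
    zetaTerm α (z + p) n = zetaTerm α z n * ((n : ℂ) ^ p)⁻¹ := by
  rcases Nat.eq_zero_or_pos n with rfl | hn
  · have : 1 ≤ (z + p).re := by simpa using le_add_of_le_of_nonneg hz p.cast_nonneg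
    rw [zetaTerm_zero this, zetaTerm_zero hz, zero_mul]
  · have : (n : ℂ) ≠ 0 := by exact_mod_cast hn.ne'
    rw [zetaTerm, zetaTerm, cpow_add _ _ this, cpow_natCast, mul_inv, mul_assoc]

lemma hasSum_Zfn_add {α : ℝ} {z : ℂ} (hz : 1 ≤ z.re) {p : ℕ} (hp : 1 ≤ p) :
    HasSum (fun n => zetaTerm α z n * ((n : ℂ) ^ p)⁻¹) (Zfn (z + p) α) := by
  have h1 : 1 ≤ (z + p).re := by simpa using le_add_of_le_of_nonneg hz p.cast_nonneg
  rw [Zfn_eq_tsum h1]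
  simp only [zetaTerm_add hz]
  refine Summable.hasSum (Summable.of_norm_bounded
    (Real.summable_nat_pow_inv.2 (show 1 < p + 1 by omega)) fun n => ?_)
  rw [norm_mul, pow_succ', mul_inv, norm_inv, norm_pow, Complex.norm_natCast]
  gcongr
  exact norm_zetaTerm_le hz n

lemma Zfn_two : Zfn 2 0 = ((∑' m : ℕ, (((m : ℝ) + 1) ^ 2)⁻¹ : ℝ) : ℂ) := by
  rw [Zfn_eq_tsum (by norm_num), ofReal_tsum]
  have hs : Summable (zetaTerm 0 2) := by
    have := (hasSum_Zfn_add (α := 0) (z := 1) (by simp) le_rfl).summable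
    simp only [← zetaTerm_add (z := 1) (by simp)] at this
    norm_num at this
    exact this
  rw [hs.tsum_eq_zero_add, zetaTerm_zero (by norm_num), zero_add]
  refine tsum_congr fun n => ?_
  simp [zetaTerm, efn_zero]

lemma hasSum_MTC_last {k : ℕ} {s : Fin k → ℂ} {z : ℂ} {β : Fin (k + 1) → ℝ} {α : ℝ}
    (hz : 1 ≤ z.re) (hs : ∀ j, s j = 1) (hβ : ∀ j : Fin k, β j.castSucc = 0)
    (hα : β (Fin.last k) = α) :
    HasSum (fun n => zetaTerm α z n * logCoeff k n) (MTC s z β) := by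
  have hsum : Summable fun v : Fin k → ℕ =>
      (∏ j, (v j : ℂ)⁻¹) * zetaTerm α z (∑ j, v j) := by
    refine Summable.of_norm_bounded (summable_prod_inv_div_sum k) fun v => ?_
    rw [norm_mul, norm_prod]
    simp only [norm_inv, Complex.norm_natCast]
    gcongr
    exact norm_zetaTerm_le hz _
  have h := hasSum_logCoeff_mul hsum
  rw [← tsum_pnat_pi fun v j hj => by rw [prod_eq_zero (mem_univ j) (by simp [hj]), zero_mul]] at h
  simp only [mul_comm (logCoeff k _ : ℂ)] at h
  convert h using 1
  refine tsum_congr fun m => ?_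
  simp [hs, hβ, hα, efn_zero, zetaTerm]

lemma hasSum_MTC_castSucc {k p : ℕ} {s : Fin (k + 1) → ℂ} {z : ℂ} {β : Fin (k + 2) → ℝ} {α : ℝ}
    (hz : 1 ≤ z.re) (hp : 1 ≤ p) (hs : ∀ j : Fin k, s j.castSucc = 1)
    (hsz : s (Fin.last k) = z) (hβ : ∀ j : Fin k, β j.castSucc.castSucc = 0)
    (hα : β (Fin.last k).castSucc = α) (hβ0 : β (Fin.last (k + 1)) = 0) :
    HasSum (fun n : ℕ => zetaTerm α z n *
      ((∑' m : ℕ, logCoeff k m * (((m : ℝ) + n) ^ p)⁻¹ : ℝ) : ℂ)) (MTC s p β) := by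
  set G : (Fin (k + 1) → ℕ) → ℂ := fun v =>
    (∏ j : Fin k, (v j.castSucc : ℂ)⁻¹) * zetaTerm α z (v (Fin.last k)) *
      (((∑ j, v j : ℕ) : ℂ) ^ p)⁻¹ with hG
  have hsum : Summable G := by
    refine Summable.of_norm_bounded (summable_prod_inv_div_sum (k + 1)) fun v => ?_
    rw [hG, norm_mul, norm_mul, norm_prod, Fin.prod_univ_castSucc]
    simp only [norm_inv, norm_pow, Complex.norm_natCast]
    have hpow : (((∑ j, v j : ℕ) : ℝ) ^ p)⁻¹ ≤ ((∑ j, v j : ℕ) : ℝ)⁻¹ := by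
      generalize ∑ j, v j = N
      rcases Nat.eq_zero_or_pos N with rfl | h
      · simp [show p ≠ 0 by omega]
      · have h1 : (1 : ℝ) ≤ N := by exact_mod_cast h
        gcongr
        exact le_self_pow₀ h1 (by omega)
    exact mul_le_mul (mul_le_mul_of_nonneg_left (norm_zetaTerm_le hz _) (by positivity)) hpow
      (by positivity) (by positivity)
  have hMTC : MTC s p β = ∑' v, G v := by
    rw [← tsum_pnat_pi fun v j hj => ?_]
    · refine tsum_congr fun m => ?_
      rw [Fin.prod_univ_castSucc]
      simp [hs, hβ, hα, hsz, hβ0, efn_zero, zetaTerm, hG]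
    · refine Fin.lastCases (fun hj => ?_) (fun j hj => ?_) j hj
      · simp [hG, hj, zetaTerm_zero hz]
      · rw [hG]
        dsimp only
        rw [prod_eq_zero (mem_univ j) (by simp [hj]), zero_mul, zero_mul]
  have e := (Fin.snocEquiv fun _ : Fin (k + 1) => ℕ).summable_iff.2 hsum
  have he (n : ℕ) (w : Fin k → ℕ) : G (Fin.snoc (α := fun _ => ℕ) w n) =
      (∏ j, (w j : ℂ)⁻¹) * (zetaTerm α z n * (((((∑ j, w j : ℕ) : ℝ) + n) ^ p)⁻¹ : ℝ)) := by
    rw [hG]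
    dsimp only
    rw [Fin.sum_univ_castSucc]
    simp only [Fin.snoc_castSucc, Fin.snoc_last]
    push_cast
    ring
  rw [hMTC, ← (Fin.snocEquiv fun _ : Fin (k + 1) => ℕ).tsum_eq]
  refine e.hasSum.prod_fiberwise fun n => ?_
  have hn := e.prod_factor n
  change Summable fun w : Fin k → ℕ => G (Fin.snoc (α := fun _ => ℕ) w n) at hn
  change HasSum (fun w : Fin k → ℕ => G (Fin.snoc (α := fun _ => ℕ) w n)) _
  convert hn.hasSum using 1
  simp only [he] at hn ⊢
  rw [← (hasSum_logCoeff_mul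
      (F := fun m => zetaTerm α z n * ((((m : ℝ) + n) ^ p)⁻¹ : ℝ)) hn).tsum_eq, ofReal_tsum, ← tsum_mul_left]
  refine tsum_congr fun m => ?_
  push_cast
  ring

end

theorem stmt15 (α : ℝ) (z : ℂ) (hz : 1 ≤ z.re) :
    4 * MTC (k := 4) ![1, 1, 1, z] 1 ![0, 0, 0, α, 0]
        - MTC (k := 4) ![1, 1, 1, 1] z ![0, 0, 0, 0, α]
      = 12 * MTC (k := 3) ![1, 1, z] 2 ![0, 0, α, 0]
        + 24 * (Zfn 2 0 * MTC (k := 2) ![1, z] 1 ![0, α, 0]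
            - MTC (k := 2) ![1, z] 3 ![0, α, 0]
            - Zfn 2 0 * Zfn (z + 2) α + Zfn (z + 4) α) := by
  have h1 := hasSum_MTC_castSucc (k := 3) (p := 1) (s := ![1, 1, 1, z]) (β := ![0, 0, 0, α, 0]) (α := α)
    hz le_rfl (fun j => by fin_cases j <;> rfl) rfl (fun j => by fin_cases j <;> rfl) rfl rfl
  have h2 := hasSum_MTC_last (k := 4) (s := ![1, 1, 1, 1]) (β := ![0, 0, 0, 0, α]) (α := α)
    hz (fun j => by fin_cases j <;> rfl) (fun j => by fin_cases j <;> rfl) rfl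
  have h3 := hasSum_MTC_castSucc (k := 2) (p := 2) (s := ![1, 1, z]) (β := ![0, 0, α, 0]) (α := α)
    hz (by norm_num) (fun j => by fin_cases j <;> rfl) rfl (fun j => by fin_cases j <;> rfl) rfl rfl
  have h4 := hasSum_MTC_castSucc (k := 1) (p := 1) (s := ![1, z]) (β := ![0, α, 0]) (α := α)
    hz le_rfl (fun j => by fin_cases j; rfl) rfl (fun j => by fin_cases j; rfl) rfl rfl
  have h5 := hasSum_MTC_castSucc (k := 1) (p := 3) (s := ![1, z]) (β := ![0, α, 0]) (α := α)
    hz (by norm_num) (fun j => by fin_cases j; rfl) rfl (fun j => by fin_cases j; rfl) rfl rfl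
  have h6 := hasSum_Zfn_add (α := α) hz (p := 2) (by norm_num)
  have h7 := hasSum_Zfn_add (α := α) hz (p := 4) (by norm_num)
  rw [Zfn_two]
  have hL := (h1.mul_left 4).sub h2
  have hR := (h3.mul_left 12).add
    (((((h4.mul_left ((∑' m : ℕ, (((m : ℝ) + 1) ^ 2)⁻¹ : ℝ) : ℂ)).sub h5).sub
      (h6.mul_left ((∑' m : ℕ, (((m : ℝ) + 1) ^ 2)⁻¹ : ℝ) : ℂ))).add h7).mul_left 24)
  simp only [Nat.cast_one, Nat.cast_ofNat] at hL hR
  refine hL.unique (hR.congr_fun fun n => ?_)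
  rcases n with _ | n
  · simp [zetaTerm_zero hz]
  · have h := congrArg (fun x : ℝ => zetaTerm α z (n + 1) * (x : ℂ)) (logCoeff_identity n)
    simp only [pow_one]
    push_cast [← add_assoc] at h ⊢
    linear_combination h
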